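/- arXiv:1302.2737 — 5 statements merged into one kernel-verified Lean document; each statement's English description precedes it below -/
import Mathlib

section
/- Let A and B be cochain complexes over F₂ each equipped with a nice cup_i-structure, and let A ⊗ B be their tensor product equipped with the operations induced by the diagonal of E(2). Then these operations form a cup_i-structure on A ⊗ B (in particular the Leibniz rule holds), and this cup_i-structure is nice: (i) x ∪_d x = x for every x ∈ (A ⊗ B)^d, and (ii) x ∪_i x' = 0 whenever x ∈ (A ⊗ B)^d, x' ∈ (A ⊗ B)^{d'} and i > min(d, d'). -/
/-- A cochain complex over `𝔽₂` (with homogeneous components realized as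
submodules `deg n` of an ambient module), equipped with a `cup_i`-structure:
a family of bilinear maps `cup i : A^r × A^s → A^(r+s-i)` for `i ≥ 0`, with
the convention `cup i = 0` for `i < 0`, satisfying the Leibniz rule. -/
structure CupComplex (M : Type*) [AddCommGroup M] [Module (ZMod 2) M] where
  /-- homogeneous component of degree `n` -/
  deg : ℤ → Submodule (ZMod 2) M
  /-- the differential -/
  d : M →ₗ[ZMod 2] M
  /-- the family of `cup_i`-products -/
  cup : ℤ → M →ₗ[ZMod 2] M →ₗ[ZMod 2] M
  deg_neg : ∀ n : ℤ, n < 0 → deg n = ⊥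
  d_mem : ∀ (n : ℤ) (x : M), x ∈ deg n → d x ∈ deg (n + 1)
  d_squared : ∀ x : M, d (d x) = 0
  cup_neg : ∀ i : ℤ, i < 0 → cup i = 0
  cup_mem : ∀ (i r s : ℤ) (x y : M), x ∈ deg r → y ∈ deg s →
    cup i x y ∈ deg (r + s - i)
  leibniz : ∀ (i r s : ℤ) (x y : M), x ∈ deg r → y ∈ deg s →
    d (cup i x y) =
      cup (i - 1) x y + cup (i - 1) y x + cup i (d x) y + cup i x (d y)

/-- A `cup_i`-structure is *nice* if `x ∪_{|x|} x = x` for homogeneous `x`, and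
`x ∪_i x' = 0` whenever `i > min (|x|, |x'|)` for homogeneous `x`, `x'`. -/
def CupComplex.Nice {M : Type*} [AddCommGroup M] [Module (ZMod 2) M]
    (S : CupComplex M) : Prop :=
  (∀ (n : ℤ) (x : M), x ∈ S.deg n → S.cup n x x = x) ∧
  (∀ (i r s : ℤ) (x y : M), x ∈ S.deg r → y ∈ S.deg s → min r s < i →
    S.cup i x y = 0)

open scoped TensorProduct

section Tensor

variable {M N : Type*} [AddCommGroup M] [Module (ZMod 2) M]
  [AddCommGroup N] [Module (ZMod 2) N]

/-- Degree-`k` component of the tensor product complex: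
`(A ⊗ B)^k = ⊕_{p+q=k} A^p ⊗ B^q`. -/
noncomputable def tensorDeg (SA : CupComplex M) (SB : CupComplex N) (k : ℤ) :
    Submodule (ZMod 2) (M ⊗[ZMod 2] N) :=
  ⨆ p : ℤ, Submodule.map₂ (TensorProduct.mk (ZMod 2) M N) (SA.deg p) (SB.deg (k - p))

/-- Differential of the tensor product complex: `δ(a ⊗ b) = δa ⊗ b + a ⊗ δb`. -/
noncomputable def tensorD (SA : CupComplex M) (SB : CupComplex N) :
    M ⊗[ZMod 2] N →ₗ[ZMod 2] M ⊗[ZMod 2] N :=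
  TensorProduct.map SA.d LinearMap.id + TensorProduct.map LinearMap.id SB.d

/-- The bilinear map on `M ⊗ N` sending `(a ⊗ b, a' ⊗ b')` to
`(cA a a') ⊗ (cB b b')`. -/
noncomputable def cupPair (cA : M →ₗ[ZMod 2] M →ₗ[ZMod 2] M)
    (cB : N →ₗ[ZMod 2] N →ₗ[ZMod 2] N) :
    (M ⊗[ZMod 2] N) →ₗ[ZMod 2] (M ⊗[ZMod 2] N) →ₗ[ZMod 2] (M ⊗[ZMod 2] N) :=
  TensorProduct.curry
    ((TensorProduct.map (TensorProduct.lift cA) (TensorProduct.lift cB)).comp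
      (TensorProduct.tensorTensorTensorComm (ZMod 2) M N M N).toLinearMap)

/-- The `cup_f`-product on `A ⊗ B` induced by the diagonal of `E(2)`:
`(a ⊗ b) ∪_f (a' ⊗ b') = Σ_{f₁+f₂=f, f₁ even} (a ∪_{f₁} a') ⊗ (b ∪_{f₂} b')
 + Σ_{f₁+f₂=f, f₁ odd} (a ∪_{f₁} a') ⊗ (b' ∪_{f₂} b)`, the sums running
over `f₁, f₂ ≥ 0` with `f₁ + f₂ = f`. -/
noncomputable def tensorCup (SA : CupComplex M) (SB : CupComplex N) (f : ℤ) :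
    (M ⊗[ZMod 2] N) →ₗ[ZMod 2] (M ⊗[ZMod 2] N) →ₗ[ZMod 2] (M ⊗[ZMod 2] N) :=
  ∑ f₁ ∈ Finset.Icc (0 : ℤ) f,
    if Even f₁ then cupPair (SA.cup f₁) (SB.cup (f - f₁))
    else cupPair (SA.cup f₁) ((SB.cup (f - f₁)).flip)

end Tensor

section Tensor

variable {M N : Type*} [AddCommGroup M] [Module (ZMod 2) M]
  [AddCommGroup N] [Module (ZMod 2) N]

theorem CupComplex.Nice.cup_comm_of_mem_deg {S : CupComplex M} (hS : S.Nice) {n : ℤ} {x y : M}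
    (hx : x ∈ S.deg n) (hy : y ∈ S.deg n) : S.cup n x y = S.cup n y x := by
  have h := hS.1 n (x + y) (add_mem hx hy)
  simp only [map_add, LinearMap.add_apply, hS.1 n x hx, hS.1 n y hy] at h
  rw [← sub_eq_zero, ZModModule.sub_eq_add]
  linear_combination (norm := module) h

theorem CupComplex.eq_zero_of_mem_deg_of_neg (S : CupComplex M) {n : ℤ} {x : M}
    (hx : x ∈ S.deg n) (hn : n < 0) : x = 0 := by
  simpa [S.deg_neg n hn] using hx

variable (SA : CupComplex M) (SB : CupComplex N)

theorem tmul_mem_tensorDeg {p q k : ℤ} (h : p + q = k) {a : M} {b : N}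
    (ha : a ∈ SA.deg p) (hb : b ∈ SB.deg q) : a ⊗ₜ[ZMod 2] b ∈ tensorDeg SA SB k := by
  obtain rfl : q = k - p := by lia
  exact Submodule.mem_iSup_of_mem p (Submodule.apply_mem_map₂ _ ha hb)

@[elab_as_elim]
theorem tensorDeg_induction {k : ℤ} {P : M ⊗[ZMod 2] N → Prop} (zero : P 0)
    (add : ∀ x y, P x → P y → P (x + y))
    (tmul : ∀ (p q : ℤ) (a : M) (b : N), p + q = k → a ∈ SA.deg p → b ∈ SB.deg q →
      P (a ⊗ₜ b))
    {x : M ⊗[ZMod 2] N} (hx : x ∈ tensorDeg SA SB k) : P x := by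
  let S : Submodule (ZMod 2) (M ⊗[ZMod 2] N) :=
    { carrier := {x | P x}
      zero_mem' := zero
      add_mem' := fun {x y} hx hy => add x y hx hy
      smul_mem' := fun c x hx => by
        obtain rfl | rfl : c = 0 ∨ c = 1 := by decide +revert
        · simpa using zero
        · simpa using hx }
  have h : tensorDeg SA SB k ≤ S :=
    iSup_le fun p => Submodule.map₂_le.2 fun a ha b hb => tmul p (k - p) a b (by lia) ha hb
  exact h hx

@[simp]
theorem tensorD_tmul (a : M) (b : N) :
    tensorD SA SB (a ⊗ₜ b) = SA.d a ⊗ₜ b + a ⊗ₜ SB.d b := by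
  simp [tensorD]

theorem tensorCup_tmul (f : ℤ) (a a' : M) (b b' : N) :
    tensorCup SA SB f (a ⊗ₜ b) (a' ⊗ₜ b') =
      ∑ j ∈ Finset.Icc (0 : ℤ) f,
        SA.cup j a a' ⊗ₜ[ZMod 2]
          (if Even j then SB.cup (f - j) b b' else SB.cup (f - j) b' b) := by
  simp only [tensorCup, LinearMap.sum_apply]
  refine Finset.sum_congr rfl fun j _ => ?_
  split_ifs <;> simp [cupPair]

theorem sum_Icc_zero_sub_one {G : Type*} [AddCommMonoid G] {T : ℤ → G} (f : ℤ) (hT : T (-1) = 0) :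
    ∑ j ∈ Finset.Icc 0 f, T (j - 1) = ∑ j ∈ Finset.Icc 0 (f - 1), T j := by
  rw [Finset.sum_nbij' (t := Finset.Icc (-1) (f - 1)) (g := T) (· - 1) (· + 1)]
  · refine (Finset.sum_subset (Finset.Icc_subset_Icc_left (by lia)) fun j hj hj' => ?_).symm
    obtain rfl : j = -1 := by simp only [Finset.mem_Icc] at hj hj'; lia
    exact hT
  all_goals simp only [Finset.mem_Icc]; grind

theorem sum_Icc_zero_eq_sum_Icc_sub_one {G : Type*} [AddCommMonoid G] {T : ℤ → G} (f : ℤ)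
    (hT : T f = 0) :
    ∑ j ∈ Finset.Icc 0 f, T j = ∑ j ∈ Finset.Icc 0 (f - 1), T j := by
  refine (Finset.sum_subset (Finset.Icc_subset_Icc_right (by lia)) fun j hj hj' => ?_).symm
  obtain rfl : j = f := by simp only [Finset.mem_Icc] at hj hj'; lia
  exact hT

theorem tensorDeg_neg {k : ℤ} (hk : k < 0) : tensorDeg SA SB k = ⊥ := by
  refine iSup_eq_bot.2 fun p => ?_
  by_cases hp : p < 0
  · simp [SA.deg_neg p hp]
  · simp [SB.deg_neg (k - p) (by lia)]

theorem tensorD_mem {k : ℤ} {x : M ⊗[ZMod 2] N} (hx : x ∈ tensorDeg SA SB k) :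
    tensorD SA SB x ∈ tensorDeg SA SB (k + 1) := by
  refine tensorDeg_induction SA SB (by simp) (fun x y hx hy => ?_)
    (fun p q a b h ha hb => ?_) hx
  · simpa using add_mem hx hy
  · rw [tensorD_tmul]
    exact add_mem (tmul_mem_tensorDeg SA SB (by lia) (SA.d_mem p a ha) hb)
      (tmul_mem_tensorDeg SA SB (by lia) ha (SB.d_mem q b hb))

theorem tensorD_tensorD (x : M ⊗[ZMod 2] N) : tensorD SA SB (tensorD SA SB x) = 0 := by
  induction x with
  | zero => simp
  | add x y hx hy => simp [hx, hy]
  | tmul a b => simp [SA.d_squared, SB.d_squared, ZModModule.add_self]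

theorem tensorCup_neg {i : ℤ} (hi : i < 0) : tensorCup SA SB i = 0 := by
  simp [tensorCup, Finset.Icc_eq_empty_of_lt hi]

@[elab_as_elim]
theorem tensorDeg_induction₂ {r s : ℤ} {P : M ⊗[ZMod 2] N → M ⊗[ZMod 2] N → Prop}
    (zero_left : ∀ y, P 0 y) (zero_right : ∀ x, P x 0)
    (add_left : ∀ x x' y, P x y → P x' y → P (x + x') y)
    (add_right : ∀ x y y', P x y → P x y' → P x (y + y'))
    (tmul : ∀ (p q p' q' : ℤ) (a a' : M) (b b' : N), p + q = r → p' + q' = s →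
      a ∈ SA.deg p → b ∈ SB.deg q → a' ∈ SA.deg p' → b' ∈ SB.deg q' →
      P (a ⊗ₜ b) (a' ⊗ₜ b'))
    {x y : M ⊗[ZMod 2] N} (hx : x ∈ tensorDeg SA SB r) (hy : y ∈ tensorDeg SA SB s) :
    P x y := by
  refine tensorDeg_induction SA SB (zero_left y) (fun x x' => add_left x x' y)
    (fun p q a b h ha hb => ?_) hx
  exact tensorDeg_induction SA SB (zero_right _) (add_right _)
    (fun p' q' a' b' h' ha' hb' => tmul p q p' q' a a' b b' h h' ha hb ha' hb') hy

theorem tensorCup_mem {i r s : ℤ} {x y : M ⊗[ZMod 2] N}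
    (hx : x ∈ tensorDeg SA SB r) (hy : y ∈ tensorDeg SA SB s) :
    tensorCup SA SB i x y ∈ tensorDeg SA SB (r + s - i) := by
  refine tensorDeg_induction₂ SA SB (by simp) (by simp) (fun x x' y h h' => ?_)
    (fun x y y' h h' => ?_) (fun p q p' q' a a' b b' h h' ha hb ha' hb' => ?_) hx hy
  · simpa using add_mem h h'
  · simpa using add_mem h h'
  · rw [tensorCup_tmul]
    refine sum_mem fun j _ => ?_
    refine tmul_mem_tensorDeg SA SB (q := q + q' - (i - j)) (by lia)
      (SA.cup_mem j p p' a a' ha ha') ?_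
    split_ifs
    · exact SB.cup_mem _ _ _ _ _ hb hb'
    · exact add_comm q q' ▸ SB.cup_mem _ _ _ _ _ hb' hb

theorem tensorCup_leibniz_tmul {f p q p' q' : ℤ} {a a' : M} {b b' : N} (ha : a ∈ SA.deg p)
    (hb : b ∈ SB.deg q) (ha' : a' ∈ SA.deg p') (hb' : b' ∈ SB.deg q') :
    tensorD SA SB (tensorCup SA SB f (a ⊗ₜ b) (a' ⊗ₜ b')) =
      tensorCup SA SB (f - 1) (a ⊗ₜ b) (a' ⊗ₜ b') +
      tensorCup SA SB (f - 1) (a' ⊗ₜ b') (a ⊗ₜ b) +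
      tensorCup SA SB f (tensorD SA SB (a ⊗ₜ b)) (a' ⊗ₜ b') +
      tensorCup SA SB f (a ⊗ₜ b) (tensorD SA SB (a' ⊗ₜ b')) := by
  let B (j : ℤ) (b b' : N) : N := if Even j then SB.cup (f - j) b b' else SB.cup (f - j) b' b
  let T₁ (j : ℤ) : M ⊗[ZMod 2] N := (SA.cup j a a' + SA.cup j a' a) ⊗ₜ B (j + 1) b b'
  let T₂ (j : ℤ) : M ⊗[ZMod 2] N :=
    SA.cup j a a' ⊗ₜ (SB.cup (f - 1 - j) b b' + SB.cup (f - 1 - j) b' b)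
  have hB (j : ℤ) : SB.d (B j b b') =
      (SB.cup (f - 1 - j) b b' + SB.cup (f - 1 - j) b' b) + B j (SB.d b) b' + B j b (SB.d b') := by
    simp only [B]
    split_ifs
    · rw [SB.leibniz _ _ _ _ _ hb hb', sub_right_comm]
    · rw [SB.leibniz _ _ _ _ _ hb' hb, sub_right_comm]
      abel
  have shift : ∑ j ∈ Finset.Icc 0 f, (T₁ (j - 1) + T₂ j) =
      tensorCup SA SB (f - 1) (a ⊗ₜ b) (a' ⊗ₜ b') +
      tensorCup SA SB (f - 1) (a' ⊗ₜ b') (a ⊗ₜ b) := by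
    rw [Finset.sum_add_distrib, sum_Icc_zero_sub_one f (by simp [T₁, SA.cup_neg]),
      sum_Icc_zero_eq_sum_Icc_sub_one f (T := T₂) (by simp [T₂, SB.cup_neg]), tensorCup_tmul,
      tensorCup_tmul, ← Finset.sum_add_distrib, ← Finset.sum_add_distrib]
    refine Finset.sum_congr rfl fun j _ => ?_
    have hj : f - (j + 1) = f - 1 - j := by ring
    simp only [T₁, T₂, B, Int.even_add_one, hj]
    by_cases h : Even j
    · simp only [h, not_true_eq_false, if_true, if_false, TensorProduct.add_tmul,
        TensorProduct.tmul_add]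
      linear_combination (norm := module)
        ZModModule.add_self (SA.cup j a a' ⊗ₜ[ZMod 2] SB.cup (f - 1 - j) b' b)
    · simp only [h, not_false_eq_true, if_true, if_false, TensorProduct.add_tmul,
        TensorProduct.tmul_add]
      linear_combination (norm := module)
        ZModModule.add_self (SA.cup j a a' ⊗ₜ[ZMod 2] SB.cup (f - 1 - j) b b')
  rw [← shift]
  simp only [tensorD_tmul, map_add, LinearMap.add_apply, tensorCup_tmul, map_sum,
    ← Finset.sum_add_distrib]
  refine Finset.sum_congr rfl fun j _ => ?_
  change SA.d (SA.cup j a a') ⊗ₜ B j b b' + SA.cup j a a' ⊗ₜ SB.d (B j b b') =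
    T₁ (j - 1) + T₂ j + (SA.cup j (SA.d a) a' ⊗ₜ B j b b' + SA.cup j a a' ⊗ₜ B j (SB.d b) b') +
      (SA.cup j a (SA.d a') ⊗ₜ B j b b' + SA.cup j a a' ⊗ₜ B j b (SB.d b'))
  rw [hB, SA.leibniz j p p' a a' ha ha']
  simp only [T₁, T₂, sub_add_cancel, TensorProduct.add_tmul, TensorProduct.tmul_add]
  abel

theorem tensorCup_leibniz {f r s : ℤ} {x y : M ⊗[ZMod 2] N}
    (hx : x ∈ tensorDeg SA SB r) (hy : y ∈ tensorDeg SA SB s) :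
    tensorD SA SB (tensorCup SA SB f x y) =
      tensorCup SA SB (f - 1) x y + tensorCup SA SB (f - 1) y x +
      tensorCup SA SB f (tensorD SA SB x) y + tensorCup SA SB f x (tensorD SA SB y) := by
  refine tensorDeg_induction₂ SA SB (by simp) (by simp) (fun x x' y h h' => ?_)
    (fun x y y' h h' => ?_) (fun p q p' q' a a' b b' h h' ha hb ha' hb' =>
      tensorCup_leibniz_tmul SA SB ha hb ha' hb') hx hy
  · simp only [map_add, LinearMap.add_apply, h, h']
    abel
  · simp only [map_add, LinearMap.add_apply, h, h']
    abel

variable {SA SB}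

theorem cup_tmul_cup_eq_zero (hA : SA.Nice) (hB : SB.Nice) {f j p q p' q' : ℤ} {a a' : M}
    {b b' : N} (ha : a ∈ SA.deg p) (hb : b ∈ SB.deg q) (ha' : a' ∈ SA.deg p')
    (hb' : b' ∈ SB.deg q') (h : min p p' < j ∨ min q q' < f - j) :
    SA.cup j a a' ⊗ₜ[ZMod 2]
      (if Even j then SB.cup (f - j) b b' else SB.cup (f - j) b' b) = 0 := by
  rcases h with h | h
  · simp [hA.2 j p p' a a' ha ha' h]
  · simp [hB.2 _ q q' b b' hb hb' h, hB.2 _ q' q b' b hb' hb (min_comm q q' ▸ h)]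

theorem tensorCup_eq_zero_of_min_lt (hA : SA.Nice) (hB : SB.Nice) {i r s : ℤ}
    {x y : M ⊗[ZMod 2] N} (hx : x ∈ tensorDeg SA SB r) (hy : y ∈ tensorDeg SA SB s)
    (hi : min r s < i) : tensorCup SA SB i x y = 0 := by
  refine tensorDeg_induction₂ SA SB (by simp) (by simp) (fun x x' y h h' => by simp [h, h'])
    (fun x y y' h h' => by simp [h, h'])
    (fun p q p' q' a a' b b' h h' ha hb ha' hb' => ?_) hx hy
  rw [tensorCup_tmul]
  exact Finset.sum_eq_zero fun j _ => cup_tmul_cup_eq_zero hA hB ha hb ha' hb' (by lia)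

theorem tensorCup_tmul_add (hA : SA.Nice) (hB : SB.Nice) {p q : ℤ} {a a' : M} {b b' : N}
    (ha : a ∈ SA.deg p) (hb : b ∈ SB.deg q) (ha' : a' ∈ SA.deg p) (hb' : b' ∈ SB.deg q) :
    tensorCup SA SB (p + q) (a ⊗ₜ b) (a' ⊗ₜ b') = SA.cup p a a' ⊗ₜ SB.cup q b b' := by
  by_cases hp : p < 0
  · simp [SA.eq_zero_of_mem_deg_of_neg ha hp]
  by_cases hq : q < 0
  · simp [SB.eq_zero_of_mem_deg_of_neg hb hq]
  rw [tensorCup_tmul, Finset.sum_eq_single_of_mem p (by simp only [Finset.mem_Icc]; lia)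
    fun j _ hj => cup_tmul_cup_eq_zero hA hB ha hb ha' hb' (by lia)]
  simp [hB.cup_comm_of_mem_deg hb' hb]

theorem tensorCup_comm_of_mem_tensorDeg (hA : SA.Nice) (hB : SB.Nice) {k : ℤ}
    {x y : M ⊗[ZMod 2] N} (hx : x ∈ tensorDeg SA SB k) (hy : y ∈ tensorDeg SA SB k) :
    tensorCup SA SB k x y = tensorCup SA SB k y x := by
  refine tensorDeg_induction₂ SA SB (by simp) (by simp) (fun x x' y h h' => by simp [h, h'])
    (fun x y y' h h' => by simp [h, h'])
    (fun p q p' q' a a' b b' h h' ha hb ha' hb' => ?_) hx hy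
  by_cases hp : p = p'
  · obtain rfl := hp
    obtain rfl : q = q' := by lia
    obtain rfl := h
    rw [tensorCup_tmul_add hA hB ha hb ha' hb', tensorCup_tmul_add hA hB ha' hb' ha hb,
      hA.cup_comm_of_mem_deg ha ha', hB.cup_comm_of_mem_deg hb hb']
  · rw [tensorCup_tmul, tensorCup_tmul,
      Finset.sum_eq_zero fun j _ => cup_tmul_cup_eq_zero hA hB ha hb ha' hb' (by lia),
      Finset.sum_eq_zero fun j _ => cup_tmul_cup_eq_zero hA hB ha' hb' ha hb (by lia)]

theorem tensorCup_self (hA : SA.Nice) (hB : SB.Nice) {k : ℤ} {x : M ⊗[ZMod 2] N}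
    (hx : x ∈ tensorDeg SA SB k) : tensorCup SA SB k x x = x := by
  refine (tensorDeg_induction SA SB (P := fun x => x ∈ tensorDeg SA SB k ∧
    tensorCup SA SB k x x = x) (by simp) ?_ ?_ hx).2
  · rintro x y ⟨hx, hxx⟩ ⟨hy, hyy⟩
    refine ⟨add_mem hx hy, ?_⟩
    simp only [map_add, LinearMap.add_apply, hxx, hyy,
      tensorCup_comm_of_mem_tensorDeg hA hB hy hx]
    linear_combination (norm := module) ZModModule.add_self (tensorCup SA SB k x y)
  · rintro p q a b rfl ha hb
    refine ⟨tmul_mem_tensorDeg SA SB rfl ha hb, ?_⟩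
    rw [tensorCup_tmul_add hA hB ha hb ha hb, hA.1 p a ha, hB.1 q b hb]

variable (SA SB) in
/-- The tensor product of two complexes with `cup_i`-structures, with the `cup_i`-structure
induced by the diagonal of `E(2)`. -/
noncomputable def tensorCupComplex : CupComplex (M ⊗[ZMod 2] N) where
  deg := tensorDeg SA SB
  d := tensorD SA SB
  cup := tensorCup SA SB
  deg_neg _ := tensorDeg_neg SA SB
  d_mem _ _ := tensorD_mem SA SB
  d_squared := tensorD_tensorD SA SB
  cup_neg _ := tensorCup_neg SA SB
  cup_mem _ _ _ _ _ := tensorCup_mem SA SB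
  leibniz _ _ _ _ _ := tensorCup_leibniz SA SB

end Tensor

/-- The tensor product of two nice `cup_i`-structures, with the
operations induced by the diagonal of `E(2)`, is again a `cup_i`-structure (in
particular the Leibniz rule holds), and it is nice. -/
theorem tensor_cupComplex_nice {M N : Type*}
    [AddCommGroup M] [Module (ZMod 2) M] [AddCommGroup N] [Module (ZMod 2) N]
    (SA : CupComplex M) (SB : CupComplex N) (hA : SA.Nice) (hB : SB.Nice) :
    ∃ S : CupComplex (M ⊗[ZMod 2] N),
      S.deg = tensorDeg SA SB ∧ S.d = tensorD SA SB ∧ S.cup = tensorCup SA SB ∧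
      S.Nice := by
  exact ⟨tensorCupComplex SA SB, rfl, rfl, rfl, fun _ _ => tensorCup_self hA hB,
    fun _ _ _ _ _ => tensorCup_eq_zero_of_min_lt hA hB⟩
end

section
/- Let A be a cochain complex over F₂ equipped with a cup_i-structure. Fix integers k ≥ 0 and i. Then: (1) for every cocycle x ∈ Aᵏ, the element Sq^i(x) = x ∪_{k−i} x ∈ A^{k+i} is a cocycle; (2) if x, x' ∈ Aᵏ are cohomologous cocycles, then x ∪_{k−i} x and x' ∪_{k−i} x' are cohomologous; hence there is a well-defined map Sq^i : Hᵏ(A) → H^{k+i}(A) sending [x] to [x ∪_{k−i} x]; (3) this map is additive: Sq^i(u + v) = Sq^i(u) + Sq^i(v) for all u, v ∈ Hᵏ(A). -/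
section Cohomology

variable {M : Type*} [AddCommGroup M] [Module (ZMod 2) M]

/-- Cocycles of degree `k`. -/
def cocycles (S : CupComplex M) (k : ℤ) : Submodule (ZMod 2) M :=
  S.deg k ⊓ LinearMap.ker S.d

/-- Coboundaries of degree `k`: elements `δ z` with `z` of degree `k - 1`. -/
def coboundaries (S : CupComplex M) (k : ℤ) : Submodule (ZMod 2) M :=
  Submodule.map S.d (S.deg (k - 1))

/-- The `k`-th cohomology `H^k(A)`: cocycles of degree `k` modulo coboundaries. -/
abbrev coho (S : CupComplex M) (k : ℤ) :=
  ↥(cocycles S k) ⧸ Submodule.comap (cocycles S k).subtype (coboundaries S k)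

end Cohomology

section SteenrodSquare

variable {M : Type*} [AddCommGroup M] [Module (ZMod 2) M]

namespace CupComplex

theorem add_self_eq_zero (a : M) : a + a = 0 := by
  rw [← two_smul (ZMod 2) a, show (2 : ZMod 2) = 0 from rfl, zero_smul]

theorem coboundaries_le_cocycles (S : CupComplex M) (k : ℤ) :
    coboundaries S k ≤ cocycles S k := by
  rintro _ ⟨z, hz, rfl⟩
  exact ⟨by simpa using S.d_mem _ z hz, S.d_squared z⟩

theorem cup_self_mem_cocycles (S : CupComplex M) {k : ℤ} (i : ℤ) {x : M}
    (hx : x ∈ cocycles S k) : S.cup (k - i) x x ∈ cocycles S (k + i) := by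
  obtain ⟨hxk, hdx⟩ := hx
  refine ⟨?_, ?_⟩
  · have h := S.cup_mem (k - i) k k x x hxk hxk
    rwa [show k + k - (k - i) = k + i by ring] at h
  · rw [SetLike.mem_coe, LinearMap.mem_ker] at hdx ⊢
    simp [S.leibniz (k - i) k k x x hxk hxk, hdx, add_self_eq_zero]

/-- The product `x ∪_{j+1} y` is a homotopy witnessing commutativity of `∪_j` on cocycles. -/
theorem cup_add_cup_swap_mem_coboundaries (S : CupComplex M) {k : ℤ} (i : ℤ) {x y : M}
    (hx : x ∈ cocycles S k) (hy : y ∈ cocycles S k) :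
    S.cup (k - i) x y + S.cup (k - i) y x ∈ coboundaries S (k + i) := by
  obtain ⟨hxk, hdx⟩ := hx
  obtain ⟨hyk, hdy⟩ := hy
  rw [SetLike.mem_coe, LinearMap.mem_ker] at hdx hdy
  refine ⟨S.cup (k - i + 1) x y, ?_, ?_⟩
  · have h := S.cup_mem (k - i + 1) k k x y hxk hyk
    rwa [show k + k - (k - i + 1) = k + i - 1 by ring] at h
  · simp [S.leibniz (k - i + 1) k k x y hxk hyk, hdx, hdy]

theorem cup_self_mem_coboundaries (S : CupComplex M) {k : ℤ} (i : ℤ) {x : M}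
    (hx : x ∈ coboundaries S k) : S.cup (k - i) x x ∈ coboundaries S (k + i) := by
  have hdx := coboundaries_le_cocycles S k hx
  obtain ⟨z, hz, rfl⟩ := hx
  refine ⟨S.cup (k - i) z (S.d z) + S.cup (k - i - 1) z z, add_mem ?_ ?_, ?_⟩
  · have h := S.cup_mem (k - i) (k - 1) k z (S.d z) hz hdx.1
    rwa [show k - 1 + k - (k - i) = k + i - 1 by ring] at h
  · have h := S.cup_mem (k - i - 1) (k - 1) (k - 1) z z hz hz
    rwa [show k - 1 + (k - 1) - (k - i - 1) = k + i - 1 by ring] at h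
  · rw [map_add, S.leibniz (k - i) (k - 1) k z (S.d z) hz hdx.1,
      S.leibniz (k - i - 1) (k - 1) (k - 1) z z hz hz, S.d_squared, map_zero]
    linear_combination (norm := module) add_self_eq_zero (S.cup (k - i - 1) z (S.d z)) +
      add_self_eq_zero (S.cup (k - i - 1) (S.d z) z) +
      add_self_eq_zero (S.cup (k - i - 1 - 1) z z)

theorem cup_self_add_sub_mem_coboundaries (S : CupComplex M) {k : ℤ} (i : ℤ) {x y : M}
    (hx : x ∈ cocycles S k) (hy : y ∈ cocycles S k) :
    S.cup (k - i) (x + y) (x + y) - (S.cup (k - i) x x + S.cup (k - i) y y) ∈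
      coboundaries S (k + i) := by
  convert cup_add_cup_swap_mem_coboundaries S i hx hy using 1
  simp only [map_add, LinearMap.add_apply]
  abel

theorem cup_self_sub_cup_self_mem_coboundaries (S : CupComplex M) {k : ℤ} (i : ℤ) {x y : M}
    (hy : y ∈ cocycles S k) (hxy : x - y ∈ coboundaries S k) :
    S.cup (k - i) x x - S.cup (k - i) y y ∈ coboundaries S (k + i) := by
  have h := add_mem
    (cup_self_add_sub_mem_coboundaries S i (coboundaries_le_cocycles S k hxy) hy)
    (cup_self_mem_coboundaries S i hxy)
  rw [sub_add_cancel] at h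
  convert h using 1
  abel

/-- The map sending a cocycle `x` of degree `k` to the class of `x ∪_{k-i} x`. -/
def sqCocycles (S : CupComplex M) (k i : ℤ) : cocycles S k →ₗ[ZMod 2] coho S (k + i) :=
  AddMonoidHom.toZModLinearMap 2 <| AddMonoidHom.mk'
    (fun x => Submodule.Quotient.mk ⟨S.cup (k - i) x x, cup_self_mem_cocycles S i x.2⟩)
    fun x y => (Submodule.Quotient.eq _).2 (cup_self_add_sub_mem_coboundaries S i x.2 y.2)

/-- The Steenrod square on cohomology. -/
def sq (S : CupComplex M) (k i : ℤ) : coho S k →ₗ[ZMod 2] coho S (k + i) :=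
  Submodule.liftQ _ (sqCocycles S k i) fun _ hx =>
    (Submodule.Quotient.mk_eq_zero _).2 (cup_self_mem_coboundaries S i hx)

theorem sq_mk (S : CupComplex M) (k i : ℤ) (x : cocycles S k) :
    sq S k i (Submodule.Quotient.mk x) =
      Submodule.Quotient.mk ⟨S.cup (k - i) x x, cup_self_mem_cocycles S i x.2⟩ :=
  rfl

end CupComplex

end SteenrodSquare

/-- For a `cup_i`-structure on `A` over `𝔽₂` and integers
`k ≥ 0`, `i`: (1) for a cocycle `x ∈ A^k`, `Sq^i x = x ∪_{k-i} x ∈ A^{k+i}` is a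
cocycle; (2) cohomologous cocycles have cohomologous squares; hence (3) there is
a well-defined additive (`𝔽₂`-linear) map `Sq^i : H^k(A) → H^{k+i}(A)` sending
`[x]` to `[x ∪_{k-i} x]`. -/
theorem steenrod_square_well_defined {M : Type*}
    [AddCommGroup M] [Module (ZMod 2) M]
    (S : CupComplex M) (k i : ℤ) (hk : 0 ≤ k) :
    (∀ x : M, x ∈ cocycles S k → S.cup (k - i) x x ∈ cocycles S (k + i)) ∧
    (∀ x x' : M, x ∈ cocycles S k → x' ∈ cocycles S k →
      x - x' ∈ coboundaries S k →
      S.cup (k - i) x x - S.cup (k - i) x' x' ∈ coboundaries S (k + i)) ∧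
    (∃ Sq : coho S k →ₗ[ZMod 2] coho S (k + i),
      ∀ (x : cocycles S k) (y : cocycles S (k + i)),
        (y : M) = S.cup (k - i) (x : M) (x : M) →
        Sq (Submodule.Quotient.mk x) = Submodule.Quotient.mk y) := by
  refine ⟨fun x hx => S.cup_self_mem_cocycles i hx,
    fun x x' _ hx' h => S.cup_self_sub_cup_self_mem_coboundaries i hx' h,
    S.sq k i, fun x y hy => ?_⟩
  rw [S.sq_mk]
  exact congrArg _ (Subtype.ext hy.symm)
end

section
/- Let A be a cochain complex over F₂ equipped with a cup_i-structure. Let x ∈ Aᵏ be a cocycle, let z ∈ A^{k−1} be arbitrary, and let j ≥ 0 be an integer. Then one has the exact cochain identity (x + δz) ∪_j (x + δz) = x ∪_j x + δ( x ∪_{j+1} (δz) + z ∪_j (δz) + z ∪_{j−1} z ). In particular the cohomology class of x ∪_j x depends only on the cohomology class of the cocycle x. -/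
/-- Exact cochain identity: for a cocycle `x ∈ A^k`, any
`z ∈ A^{k-1}` and any integer `j ≥ 0`,
`(x + δz) ∪_j (x + δz) = x ∪_j x + δ(x ∪_{j+1} δz + z ∪_j δz + z ∪_{j-1} z)`.
In particular the cohomology class of `x ∪_j x` depends only on the class of `x`. -/
theorem square_of_cohomologous {M : Type*}
    [AddCommGroup M] [Module (ZMod 2) M]
    (S : CupComplex M) (k j : ℤ) (hj : 0 ≤ j)
    (x z : M) (hx : x ∈ S.deg k) (hxcocycle : S.d x = 0)
    (hz : z ∈ S.deg (k - 1)) :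
    S.cup j (x + S.d z) (x + S.d z) =
      S.cup j x x +
        S.d (S.cup (j + 1) x (S.d z) + S.cup j z (S.d z) + S.cup (j - 1) z z) := by
  have hdz : S.d z ∈ S.deg k := by simpa using S.d_mem _ _ hz
  have add_self : ∀ a : M, a + a = 0 := fun a => by
    rw [← two_smul (ZMod 2) a, show (2 : ZMod 2) = 0 from rfl, zero_smul]
  have h₁ := S.leibniz (j + 1) k k x (S.d z) hx hdz
  have h₂ := S.leibniz j (k - 1) k z (S.d z) hz hdz
  have h₃ := S.leibniz (j - 1) (k - 1) (k - 1) z z hz hz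
  simp only [S.d_squared, hxcocycle, map_zero, LinearMap.zero_apply, add_zero,
    add_sub_cancel_right, add_self, zero_add] at h₁ h₂ h₃
  simp only [map_add, LinearMap.add_apply, h₁, h₂, h₃]
  have h₄ := add_self (S.cup (j - 1) z (S.d z))
  have h₅ := add_self (S.cup (j - 1) (S.d z) z)
  linear_combination (norm := module) -h₄ - h₅
end

section
/- Let A and B be cochain complexes over F₂ each equipped with a nice cup_i-structure, and let A ⊗ B carry the operations induced by the diagonal of E(2). Then for all homogeneous elements a ∈ Aᵖ, b ∈ Bᵠ and every integer i with 0 ≤ i ≤ p + q, one has the exact cochain identity (a ⊗ b) ∪_{p+q−i} (a ⊗ b) = Σ (a ∪_{p−i₁} a) ⊗ (b ∪_{q−i₂} b), where the sum runs over all pairs of integers (i₁, i₂) with i₁ + i₂ = i, 0 ≤ i₁ ≤ p and 0 ≤ i₂ ≤ q. In other words, the external Cartan formula Sq^i(a ⊗ b) = Σ_{i₁+i₂=i} Sq^{i₁}(a) ⊗ Sq^{i₂}(b) holds at the level of cochains. -/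
open scoped TensorProduct

section Tensor

variable {M N : Type*} [AddCommGroup M] [Module (ZMod 2) M]
  [AddCommGroup N] [Module (ZMod 2) N]

theorem cupPair_tmul (cA : M →ₗ[ZMod 2] M →ₗ[ZMod 2] M)
    (cB : N →ₗ[ZMod 2] N →ₗ[ZMod 2] N) (a a' : M) (b b' : N) :
    cupPair cA cB (a ⊗ₜ b) (a' ⊗ₜ b') = cA a a' ⊗ₜ[ZMod 2] cB b b' := by
  simp [cupPair]

/-- On the diagonal the two parity cases of the tensor `cup_f`-product agree. -/
theorem tensorCup_tmul_self (SA : CupComplex M) (SB : CupComplex N) (f : ℤ) (a : M) (b : N) :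
    tensorCup SA SB f (a ⊗ₜ b) (a ⊗ₜ b) =
      ∑ f₁ ∈ Finset.Icc (0 : ℤ) f, SA.cup f₁ a a ⊗ₜ[ZMod 2] SB.cup (f - f₁) b b := by
  simp only [tensorCup, LinearMap.sum_apply]
  refine Finset.sum_congr rfl fun f₁ _ => ?_
  split_ifs <;> simp [cupPair_tmul]

end Tensor

/-- External Cartan formula at the cochain level: for nice
`cup_i`-structures on `A` and `B`, `a ∈ A^p`, `b ∈ B^q` and `0 ≤ i ≤ p + q`,
`(a ⊗ b) ∪_{p+q-i} (a ⊗ b) = Σ_{i₁+i₂=i, 0≤i₁≤p, 0≤i₂≤q}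
  (a ∪_{p-i₁} a) ⊗ (b ∪_{q-i₂} b)`,
i.e. `Sq^i (a ⊗ b) = Σ_{i₁+i₂=i} Sq^{i₁} a ⊗ Sq^{i₂} b`. -/
theorem tensor_external_cartan {M N : Type*}
    [AddCommGroup M] [Module (ZMod 2) M] [AddCommGroup N] [Module (ZMod 2) N]
    (SA : CupComplex M) (SB : CupComplex N) (hA : SA.Nice) (hB : SB.Nice)
    (p q i : ℤ) (hi0 : 0 ≤ i) (hipq : i ≤ p + q)
    (a : M) (b : N) (ha : a ∈ SA.deg p) (hb : b ∈ SB.deg q) :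
    tensorCup SA SB (p + q - i) (a ⊗ₜ[ZMod 2] b) (a ⊗ₜ[ZMod 2] b) =
      ∑ i₁ ∈ (Finset.Icc (0 : ℤ) i).filter (fun i₁ => i₁ ≤ p ∧ i - i₁ ≤ q),
        (SA.cup (p - i₁) a a) ⊗ₜ[ZMod 2] (SB.cup (q - (i - i₁)) b b) := by
  rw [tensorCup_tmul_self,
    ← Finset.sum_filter_of_ne (p := fun f₁ => f₁ ≤ p ∧ p + q - i - f₁ ≤ q)]
  · refine Finset.sum_nbij' (fun f₁ => p - f₁) (fun i₁ => p - i₁) ?_ ?_ ?_ ?_ ?_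
    · intro f₁ h
      simp only [Finset.mem_filter, Finset.mem_Icc] at h ⊢
      omega
    · intro i₁ h
      simp only [Finset.mem_filter, Finset.mem_Icc] at h ⊢
      omega
    · intros
      omega
    · intros
      omega
    · intro f₁ _
      rw [show p - (p - f₁) = f₁ by ring,
        show q - (i - (p - f₁)) = p + q - i - f₁ by ring]
  · intro f₁ _ hne
    by_contra! h
    apply hne
    by_cases hp : f₁ ≤ p
    · rw [hB.2 _ q q b b hb hb (by simpa using h hp), TensorProduct.tmul_zero]
    · rw [hA.2 _ p p a a ha ha (by simpa using hp), TensorProduct.zero_tmul]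
end

section
/- Let f : C → D be a morphism of cochain complexes over F₂ that is surjective in every degree, and let r ≥ 0 be an integer. Then the graded subspace P_r(f) ⊆ C is a subcomplex (stable under δ), and its cohomology is given by: (1) for every k ≤ r, the inclusion P_r(f) ⊆ C induces an isomorphism Hᵏ(P_r(f)) ≅ Hᵏ(C); (2) the inclusion induces an isomorphism H^{r+1}(P_r(f)) ≅ ker( H^{r+1}(C) → H^{r+1}(D) ), the kernel of the map induced by f; (3) for every k ≥ r + 2, Hᵏ(P_r(f)) = Hᵏ(ker f), where ker f is the subcomplex of C of elements annihilated by f. -/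
/-- A cochain complex over `𝔽₂`, with homogeneous components realized as
submodules `deg n` of an ambient module, vanishing in negative degrees. -/
structure CochainCpx (M : Type*) [AddCommGroup M] [Module (ZMod 2) M] where
  deg : ℤ → Submodule (ZMod 2) M
  d : M →ₗ[ZMod 2] M
  deg_neg : ∀ n : ℤ, n < 0 → deg n = ⊥
  d_mem : ∀ (n : ℤ) (x : M), x ∈ deg n → d x ∈ deg (n + 1)
  d_squared : ∀ x : M, d (d x) = 0

section

variable {M N : Type*} [AddCommGroup M] [Module (ZMod 2) M]
  [AddCommGroup N] [Module (ZMod 2) N]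

/-- The graded subspace `P_r(f) ⊆ C`: `P_r(f)^k = C^k` for `k < r`,
`P_r(f)^r = {α ∈ C^r : δ(fα) = 0}`, and `P_r(f)^k = {α ∈ C^k : fα = 0}`
for `k > r`. -/
def Pcx (C : CochainCpx M) (D : CochainCpx N) (f : M →ₗ[ZMod 2] N)
    (r k : ℤ) : Submodule (ZMod 2) M :=
  if k < r then C.deg k
  else if k = r then C.deg r ⊓ LinearMap.ker (D.d ∘ₗ f)
  else C.deg k ⊓ LinearMap.ker f

/-- The kernel subcomplex `(ker f)^k = {α ∈ C^k : fα = 0}`. -/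
def kerCx (C : CochainCpx M) (f : M →ₗ[ZMod 2] N) (k : ℤ) :
    Submodule (ZMod 2) M :=
  C.deg k ⊓ LinearMap.ker f

/-- The `k`-th cohomology of the complex with components `deg` and
differential `d`: degree-`k` cocycles modulo coboundaries coming from
degree `k - 1`. -/
abbrev Hq (deg : ℤ → Submodule (ZMod 2) M) (d : M →ₗ[ZMod 2] M) (k : ℤ) :=
  ↥(deg k ⊓ LinearMap.ker d) ⧸
    Submodule.comap (deg k ⊓ LinearMap.ker d).subtype
      (Submodule.map d (deg (k - 1)))

theorem mem_Pcx_of_lt {C : CochainCpx M} {D : CochainCpx N} {f : M →ₗ[ZMod 2] N} {r k : ℤ}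
    (h : k < r) {x : M} : x ∈ Pcx C D f r k ↔ x ∈ C.deg k := by
  simp [Pcx, h]

theorem mem_Pcx_self {C : CochainCpx M} {D : CochainCpx N} {f : M →ₗ[ZMod 2] N} {r : ℤ} {x : M} :
    x ∈ Pcx C D f r r ↔ x ∈ C.deg r ∧ D.d (f x) = 0 := by
  simp [Pcx]

theorem Pcx_of_gt {C : CochainCpx M} {D : CochainCpx N} {f : M →ₗ[ZMod 2] N} {r k : ℤ}
    (h : r < k) : Pcx C D f r k = kerCx C f k := by
  simp [Pcx, kerCx, h.not_gt, h.ne']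

theorem mem_kerCx {C : CochainCpx M} {f : M →ₗ[ZMod 2] N} {k : ℤ} {x : M} :
    x ∈ kerCx C f k ↔ x ∈ C.deg k ∧ f x = 0 := by
  simp [kerCx]

theorem Pcx_le (C : CochainCpx M) (D : CochainCpx N) (f : M →ₗ[ZMod 2] N) (r k : ℤ) :
    Pcx C D f r k ≤ C.deg k := by
  intro x hx
  rcases lt_trichotomy k r with h | rfl | h
  · exact (mem_Pcx_of_lt h).1 hx
  · exact (mem_Pcx_self.1 hx).1
  · rw [Pcx_of_gt h] at hx
    exact (mem_kerCx.1 hx).1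

/-- The graded subspace `P_r(f)` is stable under the differential. -/
theorem d_mem_Pcx {C : CochainCpx M} {D : CochainCpx N} {f : M →ₗ[ZMod 2] N}
    (hfd : ∀ x : M, f (C.d x) = D.d (f x)) {r k : ℤ} {x : M} (hx : x ∈ Pcx C D f r k) :
    C.d x ∈ Pcx C D f r (k + 1) := by
  have hdx : C.d x ∈ C.deg (k + 1) := C.d_mem k x (Pcx_le C D f r k hx)
  rcases lt_trichotomy (k + 1) r with h | rfl | h
  · exact (mem_Pcx_of_lt h).2 hdx
  · exact mem_Pcx_self.2 ⟨hdx, by rw [hfd, D.d_squared]⟩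
  · rw [Pcx_of_gt h, mem_kerCx]
    refine ⟨hdx, ?_⟩
    rcases (Int.lt_add_one_iff.1 h).eq_or_lt with rfl | h'
    · rw [hfd, (mem_Pcx_self.1 hx).2]
    · rw [Pcx_of_gt h', mem_kerCx] at hx
      rw [hfd, hx.2, map_zero]

/-- The map in degree-`k` cohomology induced by inclusions in degrees `k` and `k - 1`. -/
def Hq.incl {P Q : ℤ → Submodule (ZMod 2) M} {d : M →ₗ[ZMod 2] M} {k : ℤ}
    (hk : P k ≤ Q k) (hk' : P (k - 1) ≤ Q (k - 1)) : Hq P d k →ₗ[ZMod 2] Hq Q d k :=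
  Submodule.mapQ _ _ (Submodule.inclusion (inf_le_inf_right _ hk))
    fun _ hx => Submodule.map_mono hk' hx

theorem Hq.incl_injective {P Q : ℤ → Submodule (ZMod 2) M} {d : M →ₗ[ZMod 2] M} {k : ℤ}
    (hk : P k ≤ Q k) (hk' : P (k - 1) ≤ Q (k - 1))
    (h : ∀ z ∈ Q (k - 1), d z ∈ P k → z ∈ P (k - 1)) :
    Function.Injective (Hq.incl (d := d) hk hk') := by
  rw [injective_iff_map_eq_zero]
  intro u hu
  obtain ⟨⟨x, hx⟩, rfl⟩ := Submodule.Quotient.mk_surjective _ u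
  obtain ⟨z, hz, rfl : d z = x⟩ := (Submodule.Quotient.mk_eq_zero _).1 hu
  exact (Submodule.Quotient.mk_eq_zero _).2 ⟨z, h z hz hx.1, rfl⟩

theorem Hq.incl_surjective {P Q : ℤ → Submodule (ZMod 2) M} {d : M →ₗ[ZMod 2] M} {k : ℤ}
    (hk : P k ≤ Q k) (hk' : P (k - 1) ≤ Q (k - 1)) (h : ∀ x ∈ Q k, d x = 0 → x ∈ P k) :
    Function.Surjective (Hq.incl (d := d) hk hk') := by
  intro u
  obtain ⟨⟨x, hx⟩, rfl⟩ := Submodule.Quotient.mk_surjective _ u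
  exact ⟨Submodule.Quotient.mk ⟨x, h x hx.1 hx.2, hx.2⟩, rfl⟩

/-- Let `f : C → D` be a degreewise surjective morphism of
cochain complexes over `𝔽₂` and `r ≥ 0`. Then `P_r(f)` is a subcomplex and:
(1) for `k ≤ r` the inclusion induces an isomorphism `H^k(P_r f) ≅ H^k(C)`;
(2) the inclusion induces an isomorphism of `H^{r+1}(P_r f)` onto the kernel of
`H^{r+1}(C) → H^{r+1}(D)` (injective with image the classes killed by `f`);
(3) for `k ≥ r + 2`, `H^k(P_r f) = H^k(ker f)`. -/
theorem P_subcomplex_and_cohomology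
    (C : CochainCpx M) (D : CochainCpx N) (f : M →ₗ[ZMod 2] N)
    (hfd : ∀ x : M, f (C.d x) = D.d (f x))
    (hfdeg : ∀ (k : ℤ) (x : M), x ∈ C.deg k → f x ∈ D.deg k)
    (hfsurj : ∀ k : ℤ, ∀ y ∈ D.deg k, ∃ x ∈ C.deg k, f x = y)
    (r : ℤ) (hr : 0 ≤ r) :
    (∀ (k : ℤ) (x : M), x ∈ Pcx C D f r k → C.d x ∈ Pcx C D f r (k + 1)) ∧
    (∀ k : ℤ, k ≤ r →
      ∃ e : Hq (Pcx C D f r) C.d k ≃ₗ[ZMod 2] Hq C.deg C.d k,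
        ∀ (x : M) (hx : x ∈ Pcx C D f r k ⊓ LinearMap.ker C.d)
          (hx' : x ∈ C.deg k ⊓ LinearMap.ker C.d),
          e (Submodule.Quotient.mk ⟨x, hx⟩) = Submodule.Quotient.mk ⟨x, hx'⟩) ∧
    (∃ e : Hq (Pcx C D f r) C.d (r + 1) →ₗ[ZMod 2] Hq C.deg C.d (r + 1),
      Function.Injective e ∧
      (∀ (x : M) (hx : x ∈ Pcx C D f r (r + 1) ⊓ LinearMap.ker C.d)
        (hx' : x ∈ C.deg (r + 1) ⊓ LinearMap.ker C.d),
        e (Submodule.Quotient.mk ⟨x, hx⟩) = Submodule.Quotient.mk ⟨x, hx'⟩) ∧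
      (∀ u : Hq C.deg C.d (r + 1),
        (∃ v, e v = u) ↔
          ∃ (x : M) (hx' : x ∈ C.deg (r + 1) ⊓ LinearMap.ker C.d),
            u = Submodule.Quotient.mk ⟨x, hx'⟩ ∧
              f x ∈ Submodule.map D.d (D.deg r))) ∧
    (∀ k : ℤ, r + 2 ≤ k →
      ∃ e : Hq (Pcx C D f r) C.d k ≃ₗ[ZMod 2] Hq (kerCx C f) C.d k,
        ∀ (x : M) (hx : x ∈ Pcx C D f r k ⊓ LinearMap.ker C.d)
          (hx' : x ∈ kerCx C f k ⊓ LinearMap.ker C.d),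
          e (Submodule.Quotient.mk ⟨x, hx⟩) = Submodule.Quotient.mk ⟨x, hx'⟩) := by
  refine ⟨fun k x hx => d_mem_Pcx hfd hx, fun k hk => ?_, ?_, fun k hk => ?_⟩
  · refine ⟨LinearEquiv.ofBijective
      (Hq.incl (Pcx_le C D f r k) (Pcx_le C D f r (k - 1)))
      ⟨Hq.incl_injective _ _ fun z hz _ => (mem_Pcx_of_lt (by lia)).2 hz,
        Hq.incl_surjective _ _ fun x hx hdx => ?_⟩, fun _ _ _ => rfl⟩
    rcases hk.eq_or_lt with rfl | h
    · exact mem_Pcx_self.2 ⟨hx, by rw [← hfd, hdx, map_zero]⟩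
    · exact (mem_Pcx_of_lt h).2 hx
  · have hP : Pcx C D f r (r + 1) = kerCx C f (r + 1) := Pcx_of_gt (lt_add_one r)
    refine ⟨Hq.incl (Pcx_le C D f r (r + 1)) (Pcx_le C D f r (r + 1 - 1)),
      Hq.incl_injective _ _ fun z hz hdz => ?_, fun _ _ _ => rfl, fun u => ⟨?_, ?_⟩⟩
    · rw [hP, mem_kerCx] at hdz
      rw [add_sub_cancel_right] at hz ⊢
      exact mem_Pcx_self.2 ⟨hz, by rw [← hfd, hdz.2]⟩
    · rintro ⟨v, rfl⟩
      obtain ⟨⟨x, hx⟩, rfl⟩ := Submodule.Quotient.mk_surjective _ v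
      refine ⟨x, ⟨Pcx_le C D f r _ hx.1, hx.2⟩, rfl, ?_⟩
      have hx' : x ∈ Pcx C D f r (r + 1) := hx.1
      rw [hP, mem_kerCx] at hx'
      rw [hx'.2]
      exact zero_mem _
    · rintro ⟨x, hx, rfl, y, hy, hyx⟩
      obtain ⟨z, hz, rfl⟩ := hfsurj r y hy
      have hxz : x - C.d z ∈ Pcx C D f r (r + 1) := by
        rw [hP, mem_kerCx]
        exact ⟨sub_mem hx.1 (C.d_mem r z hz), by rw [map_sub, hfd, hyx, sub_self]⟩
      have hd : C.d (x - C.d z) = 0 := by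
        rw [map_sub, C.d_squared, sub_zero]
        exact hx.2
      refine ⟨Submodule.Quotient.mk ⟨x - C.d z, hxz, hd⟩, ?_⟩
      symm
      apply (Submodule.Quotient.eq _).2
      refine ⟨z, ?_, (sub_sub_cancel x (C.d z)).symm⟩
      rwa [add_sub_cancel_right]
  · have hk₀ : Pcx C D f r k = kerCx C f k := Pcx_of_gt (by lia)
    have hk₁ : Pcx C D f r (k - 1) = kerCx C f (k - 1) := Pcx_of_gt (by lia)
    exact ⟨LinearEquiv.ofBijective (Hq.incl hk₀.le hk₁.le)
      ⟨Hq.incl_injective _ _ fun z hz _ => hk₁.ge hz,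
        Hq.incl_surjective _ _ fun x hx _ => hk₀.ge hx⟩, fun _ _ _ => rfl⟩

end
end
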